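/- For any two distinct indices i, j ∈ {1, …, 8} there exist vectors v, w ∈ C₈ with |v| = |w| = 4 such that the coordinatewise product v × w equals the vector whose k-th coordinate is 1 if k ∈ {i, j} and 0 otherwise. -/

import Mathlib

/-- The rows of the matrix `M` defining the code `C₈`. -/
def rowsM : Fin 4 → (Fin 8 → ZMod 2) :=
  ![![1,1,1,1,0,0,0,0], ![0,0,1,1,1,1,0,0], ![0,0,0,0,1,1,1,1], ![1,0,1,0,1,0,1,0]]

/-- The code `C₈ ⊆ 𝔽₂^8`: the row space of the matrix `M`. -/
def C8 : Submodule (ZMod 2) (Fin 8 → ZMod 2) :=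
  Submodule.span (ZMod 2) (Set.range rowsM)

/-- The weight of a vector in `𝔽₂^d`: the number of nonzero coordinates. -/
def wt {d : ℕ} (v : Fin d → ZMod 2) : ℕ :=
  (Finset.univ.filter (fun i => v i ≠ 0)).card

theorem sum_smul_rowsM_mem_C8 (c : Fin 4 → ZMod 2) : ∑ k, c k • rowsM k ∈ C8 :=
  Submodule.sum_mem _ fun k _ =>
    Submodule.smul_mem _ _ (Submodule.subset_span (Set.mem_range_self k))

theorem exists_coeffs_mul_eq_pair : ∀ i j : Fin 8, i ≠ j → ∃ c d : Fin 4 → ZMod 2,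
    wt (∑ k, c k • rowsM k) = 4 ∧ wt (∑ k, d k • rowsM k) = 4 ∧
      (∑ k, c k • rowsM k) * (∑ k, d k • rowsM k) =
        fun k => if k = i ∨ k = j then 1 else 0 := by
  unfold wt
  decide +kernel

theorem stmt_7 (i j : Fin 8) (hij : i ≠ j) :
    ∃ v ∈ C8, ∃ w ∈ C8, wt v = 4 ∧ wt w = 4 ∧
      v * w = fun k => if k = i ∨ k = j then 1 else 0 := by
  obtain ⟨c, d, hc, hd, h⟩ := exists_coeffs_mul_eq_pair i j hij
  exact ⟨_, sum_smul_rowsM_mem_C8 c, _, sum_smul_rowsM_mem_C8 d, hc, hd, h⟩
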